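/- Let S be a semigroup, B a subsemigroup of S with xB ⊆ Bx for all x ∈ S. Then S with the left upper B-periodic topology τ is a topological semigroup: the sets B¹x = Bx ∪ {x} are open and form a basis, and multiplication is continuous (for each x,y and open U containing xy, B¹x · B¹y ⊆ B¹(xy) ⊆ U whenever B¹(xy) ⊆ U). -/

import Mathlib

open Pointwise

/-- If `B` is a subsemigroup of `S` with `xB ⊆ Bx` for all `x`, then `S` with the
left upper `B`-periodic topology is a topological semigroup: each `B¹x = Bx ∪ {x}`
is open, these sets form a basis (every open set is the union of the `B¹x` over
its points), and `B¹x * B¹y ⊆ B¹(xy)`, giving continuity of multiplication. -/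
theorem stmt10 {S : Type*} [Semigroup S] (B : Set S)
    (hB : ∀ a ∈ B, ∀ b ∈ B, a * b ∈ B)
    (hnorm : ∀ x : S, ∀ b ∈ B, ∃ b' ∈ B, x * b = b' * x) :
    (∀ x : S, B * {x} ∪ {x} ∈ {A : Set S | B * A ⊆ A}) ∧
    (∀ A : Set S, B * A ⊆ A → A = ⋃ x ∈ A, (B * {x} ∪ {x})) ∧
    (∀ x y : S, (B * {x} ∪ {x}) * (B * {y} ∪ {y}) ⊆ B * {x * y} ∪ {x * y}) := by
  have key : ∀ x z : S, z ∈ B * {x} ∪ {x} ↔ (∃ b ∈ B, b * x = z) ∨ z = x := by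
    intro x z
    simp [or_comm]
  refine ⟨?_, ?_, ?_⟩
  · intro x z hz
    obtain ⟨b, hb, w, hw, rfl⟩ := Set.mem_mul.1 hz
    rw [key] at hw ⊢
    rcases hw with ⟨c, hc, rfl⟩ | rfl
    · exact Or.inl ⟨b * c, hB b hb c hc, mul_assoc _ _ _⟩
    · exact Or.inl ⟨b, hb, rfl⟩
  · intro A hA
    ext z
    simp only [Set.mem_iUnion, exists_prop]
    constructor
    · intro hz
      exact ⟨z, hz, Or.inr rfl⟩
    · rintro ⟨x, hx, hz⟩
      rw [key] at hz
      rcases hz with ⟨b, hb, rfl⟩ | rfl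
      · exact hA (Set.mul_mem_mul hb hx)
      · exact hx
  · intro x y z hz
    obtain ⟨u, hu, v, hv, rfl⟩ := Set.mem_mul.1 hz
    rw [key] at hu hv ⊢
    rcases hv with ⟨c, hc, rfl⟩ | rfl
    · obtain ⟨c', hc', h⟩ := hnorm x c hc
      rcases hu with ⟨b, hb, rfl⟩ | rfl
      · refine Or.inl ⟨b * c', hB b hb c' hc', ?_⟩
        calc b * c' * (x * y) = b * ((c' * x) * y) := by simp only [mul_assoc]
          _ = b * ((x * c) * y) := by rw [h]
          _ = b * x * (c * y) := by simp only [mul_assoc]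
      · refine Or.inl ⟨c', hc', ?_⟩
        rw [← mul_assoc, ← h, mul_assoc]
    · rcases hu with ⟨b, hb, rfl⟩ | rfl
      · exact Or.inl ⟨b, hb, (mul_assoc _ _ _).symm⟩
      · exact Or.inr rfl
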